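/- arXiv:2210.03891 — 2 statements merged into one kernel-verified Lean document; each statement's English description precedes it below -/
import Mathlib

section
/- Let (R, 𝔪) be a one-dimensional Noetherian local ring whose 𝔪-adic completion is reduced. Then the conductor 𝒞(R) annihilates Ext^i_R(M, N) and Tor_i^R(M, N) for every i ≥ 1, every finitely generated torsion-free R-module M, and every (not necessarily finitely generated) R-module N. -/
open CategoryTheory Opposite

universe u

/-- The conductor of a commutative ring `S` in the integral closure `S̄` of `S` inside its total
ring of fractions `Q(S)`: the ideal `(S : S̄) = {q ∈ Q(S) : q·S̄ ⊆ S}` of `S`. -/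
noncomputable def conductorIdeal (S : Type u) [CommRing S] : Ideal S :=
  Submodule.comap (Algebra.linearMap S (Localization (nonZeroDivisors S)))
    ((1 : Submodule S (Localization (nonZeroDivisors S))) /
      (Subalgebra.toSubmodule (integralClosure S (Localization (nonZeroDivisors S)))))

noncomputable section
set_option linter.unusedVariables false
variable (R : Type u) [CommRing R]
@[reducible] def opLin : Linear R (ModuleCat.{u} R)ᵒᵖ where
  homModule X Y :=
    { smul := fun r f => (r • f.unop).op
      one_smul := fun f => Quiver.Hom.unop_inj (one_smul R f.unop)
      mul_smul := fun a b f => Quiver.Hom.unop_inj (mul_smul a b f.unop)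
      smul_zero := fun a => Quiver.Hom.unop_inj (smul_zero a)
      smul_add := fun a f g => Quiver.Hom.unop_inj (smul_add a f.unop g.unop)
      add_smul := fun a b f => Quiver.Hom.unop_inj (add_smul a b f.unop)
      zero_smul := fun f => Quiver.Hom.unop_inj (zero_smul R f.unop) }
  smul_comp X Y Z r f g := Quiver.Hom.unop_inj (Linear.comp_smul (R := R) _ _ _ g.unop r f.unop)
  comp_smul X Y Z f r g := Quiver.Hom.unop_inj (Linear.smul_comp (R := R) _ _ _ r g.unop f.unop)

variable {R}

theorem homologyMap_smul_id {D : Type*} [Category D] [Abelian D] [Linear R D]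
    {ι : Type*} {s : ComplexShape ι} (K : HomologicalComplex D s) (c : R) (φ : K ⟶ K)
    (h : ∀ i, φ.f i = c • 𝟙 _) (n : ι) :
    (HomologicalComplex.homologyFunctor D s n).map φ = c • 𝟙 _ := by
  have : (HomologicalComplex.shortComplexFunctor D s n).map φ = c • 𝟙 (K.sc n) := by
    ext <;> simp [h] <;> rfl
  change ShortComplex.homologyMap _ = _
  rw [this, ShortComplex.homologyMap_smul, ShortComplex.homologyMap_id]
  rfl

theorem leftDerived_smul_id {D : Type*} [Category D] [Abelian D] [Linear R D]
   (F : ModuleCat.{u} R ⥤ D) [F.Additive]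
   (hF : ∀ (X : ModuleCat.{u} R) (c : R), F.map (c • 𝟙 X) = c • 𝟙 _)  (c : R) (M : ModuleCat.{u} R) (n : ℕ) :
   (F.leftDerived n).map (c • 𝟙 M) = c • 𝟙 _ := by
  let P := projectiveResolution M
  rw [Functor.leftDerived_map_eq F n (c • 𝟙 M) (P := P) (Q := P) (c • 𝟙 P.complex) (by
    ext : 1
    simp only [Linear.smul_comp, Category.id_comp, HomologicalComplex.smul_f_apply, HomologicalComplex.comp_f, ChainComplex.single₀_map_f_zero]
    exact ((Linear.comp_smul _ _ _ (P.π.f 0) c (𝟙 M)).trans (congrArg (c • ·) (Category.comp_id _))).symm)]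
  rw [Functor.comp_map, homologyMap_smul_id _ c]
  · simp
  · intro i
    have := hF (P.complex.X i) c
    simpa using! this

theorem ext_kill (c : R) (M P N : ModuleCat.{u} R) [Projective P] (a : M ⟶ P) (b : P ⟶ M)
    (h : a ≫ b = c • 𝟙 M) (n : ℕ) : c ∈ Module.annihilator R (((Ext R (ModuleCat.{u} R) (n+1)).obj (op M)).obj N) := by
  letI := opLin R
  let F := ((linearYoneda R (ModuleCat.{u} R)).obj N).rightOp
  have h1 : (F.leftDerived (n+1)).map (c • 𝟙 M) = c • 𝟙 _ := by
    apply leftDerived_smul_id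
    intro X c
    apply Quiver.Hom.unop_inj
    ext (x : X ⟶ N)
    change (c • 𝟙 X) ≫ x = c • x
    simp
  have h2 : (F.leftDerived (n+1)).map (c • 𝟙 M) = 0 := by
    rw [← h, Functor.map_comp]
    rw [(F.isZero_leftDerived_obj_projective_succ n P).eq_of_tgt ((F.leftDerived (n+1)).map a) 0]
    simp
  rw [h1] at h2
  have h3 : c • 𝟙 (((Ext R (ModuleCat.{u} R) (n+1)).obj (op M)).obj N) = 0 := congrArg Quiver.Hom.unop h2
  rw [Module.mem_annihilator]
  intro m
  exact congrArg (fun f => f.hom m) h3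

theorem tor_kill (c : R) (M P N : ModuleCat.{u} R) [Module.Flat R P] (a : M ⟶ P) (b : P ⟶ M)
    (h : a ≫ b = c • 𝟙 M) (n : ℕ) : c ∈ Module.annihilator R (((Tor (ModuleCat.{u} R) (n+1)).obj M).obj N) := by
  have h1 : ((Tor (ModuleCat.{u} R) (n+1)).map (c • 𝟙 M)).app N = c • 𝟙 _ := by
    let Q := projectiveResolution N
    rw [Tor_map, ProjectiveResolution.leftDerived_app_eq _ Q, homologyMap_smul_id _ c]
    · simp
      rfl
    · intro i
      apply ModuleCat.hom_ext
      apply TensorProduct.ext'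
      intro x y
      have : (c • 𝟙 M : M ⟶ M).hom x ⊗ₜ[R] y = c • (x ⊗ₜ[R] y) := rfl
      exact this
  have h0 : Limits.IsZero (((Tor (ModuleCat.{u} R) (n+1)).obj P).obj N) := by
    let Q := projectiveResolution N
    refine Limits.IsZero.of_iso ?_ (Q.isoLeftDerivedObj ((MonoidalCategory.tensoringLeft _).obj P) (n + 1))
    erw [← HomologicalComplex.exactAt_iff_isZero_homology]
    have hQ := Q.complex_exactAt_succ n
    haveI : Limits.PreservesFiniteLimits (MonoidalCategory.tensorLeft P) :=
      (Module.Flat.iff_preservesFiniteLimits_tensorLeft P).mp inferInstance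
    have : (((MonoidalCategory.tensorLeft P))).PreservesHomology := inferInstance
    exact ShortComplex.Exact.map hQ (MonoidalCategory.tensorLeft P)
  have h2 : ((Tor (ModuleCat.{u} R) (n+1)).map (c • 𝟙 M)).app N = 0 := by
    rw [← h, Functor.map_comp, NatTrans.comp_app]
    rw [h0.eq_of_tgt (((Tor (ModuleCat.{u} R) (n+1)).map a).app N) 0]
    simp
  rw [h1] at h2
  rw [Module.mem_annihilator]
  intro m
  exact congrArg (fun f => f.hom m) h2

end

section B
variable {R : Type u} [CommRing R]

theorem red_of_compl [IsNoetherianRing R] [IsLocalRing R]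
  (hred : IsReduced (AdicCompletion (IsLocalRing.maximalIdeal R) R)) : IsReduced R := by
  refine isReduced_of_injective (algebraMap R (AdicCompletion (IsLocalRing.maximalIdeal R) R)) ?_
  have : IsHausdorff (IsLocalRing.maximalIdeal R) R := inferInstance
  have := AdicCompletion.of_injective (IsLocalRing.maximalIdeal R) R
  exact this

theorem le_min_of_disj [IsNoetherianRing R] [IsReduced R] [Nontrivial R] (I : Ideal R)
   (h : ∀ x ∈ I, x ∉ nonZeroDivisors R) : ∃ q ∈ minimalPrimes R, I ≤ q := by
  have hfin := minimalPrimes.finite_of_isNoetherianRing R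
  have hsub : (I : Set R) ⊆ ⋃ q ∈ (hfin.toFinset : Set (Ideal R)), (q : Set R) := by
    intro x hx
    have := h x hx
    rw [mem_nonZeroDivisors_iff_right] at this
    push Not at this
    obtain ⟨y, hy, hy0⟩ := this
    have hs : y ∉ sInf (minimalPrimes R) := by
      have : sInf (minimalPrimes R) = nilradical R := Ideal.sInf_minimalPrimes
      rw [this, nilradical_eq_zero]
      exact hy0
    simp only [Ideal.mem_sInf, not_forall] at hs
    obtain ⟨q, hq, hyq⟩ := hs
    simp only [Set.Finite.coe_toFinset, Set.mem_iUnion]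
    refine ⟨q, hq, ?_⟩
    have hp : q.IsPrime := hq.1.1
    exact (hp.mem_or_mem (by rw [hy]; exact q.zero_mem)).resolve_left hyq
  rw [Ideal.subset_union_prime ⊥ ⊥ (fun q hq _ _ => (hfin.mem_toFinset.mp hq).1.1)] at hsub
  obtain ⟨q, hq, h⟩ := hsub
  exact ⟨q, hfin.mem_toFinset.mp hq, h⟩

theorem art_Q [IsNoetherianRing R] [IsReduced R] [Nontrivial R] (K : Type*) [CommRing K] [Algebra R K]
   [IsFractionRing R K] : IsArtinianRing K := by
  have : IsNoetherianRing K := IsLocalization.isNoetherianRing (nonZeroDivisors R) K inferInstance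
  rw [isArtinianRing_iff_krullDimLE_zero]
  have key : ∀ P : Ideal K, P.IsPrime → P.comap (algebraMap R K) ∈ minimalPrimes R := by
    intro P hP
    obtain ⟨q, hq, hle⟩ := le_min_of_disj (P.comap (algebraMap R K)) (by
      intro x hx hx'
      exact hP.ne_top (Ideal.eq_top_of_isUnit_mem _ hx (IsLocalization.map_units K ⟨x, hx'⟩)))
    have : (P.comap (algebraMap R K)) = q := 
      le_antisymm hle (hq.2 ⟨Ideal.IsPrime.comap _, bot_le⟩ hle)
    rwa [this]
  rw [Ring.krullDimLE_zero_iff]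
  intro P hP
  obtain ⟨m, hm, hle⟩ := Ideal.exists_le_maximal P hP.ne_top
  have h1 := key P hP
  have h2 := key m hm.isPrime
  have h3 : P.comap (algebraMap R K) = m.comap (algebraMap R K) := 
    le_antisymm (Ideal.comap_mono hle) (h2.2 h1.1 (Ideal.comap_mono hle))
  have : P = m := by
    rw [← IsLocalization.map_under (nonZeroDivisors R) K P,
      ← IsLocalization.map_under (nonZeroDivisors R) K m]
    exact congrArg _ h3
  rwa [this]

theorem ex_nzd [IsNoetherianRing R] [IsReduced R] [IsLocalRing R] (hdim : ringKrullDim R = 1) :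
    ∃ t ∈ IsLocalRing.maximalIdeal R, t ∈ nonZeroDivisors R := by
  by_contra! h
  obtain ⟨q, hq, hle⟩ := le_min_of_disj _ h
  have : Ring.KrullDimLE 0 R := by
    rw [Ring.krullDimLE_zero_iff]
    intro P hP
    have h1 : P ≤ q := (IsLocalRing.le_maximalIdeal hP.ne_top).trans hle
    have h2 : q ≤ P := hq.2 ⟨hP, bot_le⟩ h1
    have : P = IsLocalRing.maximalIdeal R := le_antisymm (IsLocalRing.le_maximalIdeal hP.ne_top) (hle.trans h2)
    rw [this]; infer_instance
  rw [Ring.krullDimLE_iff, hdim] at this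
  norm_num at this

theorem fl [IsNoetherianRing R] (hdim : ringKrullDim R = 1) {t : R} (ht : t ∈ nonZeroDivisors R) :
    IsFiniteLength R (R ⧸ Ideal.span {t}) := by
  have h1 := ringKrullDim_quotient_succ_le_of_nonZeroDivisor ht
  rw [hdim] at h1
  have h2 : Ring.KrullDimLE 0 (R ⧸ Ideal.span {t}) := by
    rw [Ring.krullDimLE_iff]
    generalize ringKrullDim (R ⧸ Ideal.span {t}) = d at h1
    induction d with
    | bot => simp
    | coe d => 
      induction d with
      | top => exact absurd h1 (by decide)
      | coe d => 
        have : d + 1 ≤ 1 := by exact_mod_cast h1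
        have : d = 0 := by omega
        simp [this]
  have : IsArtinianRing (R ⧸ Ideal.span {t}) := isArtinianRing_iff_krullDimLE_zero.mpr h2
  rw [isFiniteLength_iff_isNoetherian_isArtinian]
  refine ⟨inferInstance, ?_⟩
  exact isArtinian_of_surjective_algebraMap (S := R) (R := R ⧸ Ideal.span {t}) Ideal.Quotient.mk_surjective

theorem length_IT [IsNoetherianRing R] (hdim : ringKrullDim R = 1) {t b : R}
    (ht : t ∈ nonZeroDivisors R) (hb : b ∈ nonZeroDivisors R) (I : Ideal R) (hbI : b ∈ I) :
    Module.length R (I ⧸ Submodule.comap I.subtype (Ideal.span {t} * I)) =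
      Module.length R (R ⧸ Ideal.span {t}) := by
  let J : Ideal R := Ideal.span {t} * I
  have hJI : J ≤ I := Ideal.mul_le_right
  have hJt : J ≤ Ideal.span {t} := Ideal.mul_le_left
  have hmem : ∀ x, x ∈ J ↔ ∃ y ∈ I, t * y = x := fun x => Ideal.mem_span_singleton_mul
  let f1 : (R ⧸ I) →ₗ[R] (R ⧸ J) := Submodule.mapQ I J (LinearMap.mulLeft R t) (by
    intro y hy
    exact (hmem _).2 ⟨y, hy, rfl⟩)
  let g1 : (R ⧸ J) →ₗ[R] (R ⧸ Ideal.span {t}) := Submodule.factor hJt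
  let f2 : (I ⧸ Submodule.comap I.subtype J) →ₗ[R] (R ⧸ J) := Submodule.mapQ _ J I.subtype le_rfl
  let g2 : (R ⧸ J) →ₗ[R] (R ⧸ I) := Submodule.factor hJI
  have hf1 : Function.Injective f1 := by
    rw [← LinearMap.ker_eq_bot, LinearMap.ker_eq_bot']
    intro x hx
    obtain ⟨x, rfl⟩ := Submodule.Quotient.mk_surjective _ x
    have : t * x ∈ J := (Submodule.Quotient.mk_eq_zero J).1 hx
    obtain ⟨y, hy, h⟩ := (hmem _).1 this
    rw [Submodule.Quotient.mk_eq_zero]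
    rwa [← mul_cancel_left_mem_nonZeroDivisors ht |>.1 h]
  have hg1 : Function.Surjective g1 := Submodule.factor_surjective hJt
  have hf2 : Function.Injective f2 := by
    rw [← LinearMap.ker_eq_bot, LinearMap.ker_eq_bot']
    intro x hx
    obtain ⟨x, rfl⟩ := Submodule.Quotient.mk_surjective _ x
    have : (x : R) ∈ J := (Submodule.Quotient.mk_eq_zero J).1 hx
    rw [Submodule.Quotient.mk_eq_zero]
    exact this
  have hg2 : Function.Surjective g2 := Submodule.factor_surjective hJI
  have e1 : Function.Exact f1 g1 := by
    intro x
    obtain ⟨x, rfl⟩ := Submodule.Quotient.mk_surjective _ x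
    constructor
    · intro h
      have : x ∈ Ideal.span {t} := (Submodule.Quotient.mk_eq_zero _).1 h
      obtain ⟨y, rfl⟩ := Ideal.mem_span_singleton'.1 this
      exact ⟨Submodule.Quotient.mk y, by rw [mul_comm]; rfl⟩
    · rintro ⟨y, hy⟩
      obtain ⟨y, rfl⟩ := Submodule.Quotient.mk_surjective _ y
      rw [← hy]
      exact (Submodule.Quotient.mk_eq_zero _).2 (Ideal.mem_span_singleton'.2 ⟨y, mul_comm _ _⟩)
  have e2 : Function.Exact f2 g2 := by
    intro x
    obtain ⟨x, rfl⟩ := Submodule.Quotient.mk_surjective _ x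
    constructor
    · intro h
      have : x ∈ I := (Submodule.Quotient.mk_eq_zero _).1 h
      exact ⟨Submodule.Quotient.mk ⟨x, this⟩, rfl⟩
    · rintro ⟨y, hy⟩
      obtain ⟨y, rfl⟩ := Submodule.Quotient.mk_surjective _ y
      rw [← hy]
      exact (Submodule.Quotient.mk_eq_zero _).2 y.2
  have l1 := Module.length_eq_add_of_exact f1 g1 hf1 hg1 e1
  have l2 := Module.length_eq_add_of_exact f2 g2 hf2 hg2 e2
  have hfin : Module.length R (R ⧸ I) ≠ ⊤ := by
    have h1 : Module.length R (R ⧸ I) ≤ Module.length R (R ⧸ Ideal.span {b}) :=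
      Module.length_le_of_surjective
        (Submodule.factor ((Ideal.span_singleton_le_iff_mem I).2 hbI)) (Submodule.factor_surjective _)
    have h2 := Module.length_ne_top_iff.2 (fl hdim hb)
    exact ne_top_of_le_ne_top h2 h1
  rw [l1, add_comm] at l2
  exact ((ENat.add_left_injective_of_ne_top hfin) l2).symm

theorem exists_rel [IsNoetherianRing R] [IsReduced R] [IsLocalRing R] (hdim : ringKrullDim R = 1)
    (a b : R) (hb : b ∈ nonZeroDivisors R) :
    ∃ (n : ℕ) (c : Fin (n + 1) → R), (∃ i, IsUnit (c i)) ∧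
      ∑ i, c i * (a ^ (i : ℕ) * b ^ (n - i : ℕ)) = 0 := by
  obtain ⟨t, htm, ht⟩ := ex_nzd hdim
  by_contra! H
  have hfin := Module.length_ne_top_iff.2 (fl hdim ht)
  obtain ⟨n, hn⟩ := ENat.ne_top_iff_exists.1 hfin
  let φ : (Fin (n + 1) → R) →ₗ[R] R :=
    Fintype.linearCombination R (fun i => a ^ (i : ℕ) * b ^ (n - i : ℕ))
  let I : Ideal R := LinearMap.range φ
  let k := R ⧸ IsLocalRing.maximalIdeal R
  let ψ : (Fin (n + 1) → R) →ₗ[R] (Fin (n + 1) → k) :=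
    LinearMap.pi (fun i => (Submodule.mkQ _) ∘ₗ LinearMap.proj i)
  have hψ : Function.Surjective ψ := by
    intro v
    choose w hw using fun i => Submodule.mkQ_surjective (IsLocalRing.maximalIdeal R) (v i)
    exact ⟨w, funext hw⟩
  have hker : LinearMap.ker φ ≤ LinearMap.ker ψ := by
    intro v hv
    have h1 : ∑ i, v i * (a ^ (i : ℕ) * b ^ (n - i : ℕ)) = 0 := by
      simpa [φ, Fintype.linearCombination_apply] using hv
    have h2 : ∀ i, ¬ IsUnit (v i) := fun i hi => H n v ⟨i, hi⟩ h1
    rw [LinearMap.mem_ker]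
    funext i
    exact (Submodule.Quotient.mk_eq_zero _).2 ((IsLocalRing.mem_maximalIdeal _).2 (h2 i))
  let θ : I →ₗ[R] (Fin (n + 1) → k) :=
    ((LinearMap.ker φ).liftQ ψ hker) ∘ₗ φ.quotKerEquivRange.symm.toLinearMap
  have hθ : Function.Surjective θ := by
    intro v
    obtain ⟨w, rfl⟩ := hψ v
    refine ⟨φ.quotKerEquivRange (Submodule.Quotient.mk w), ?_⟩
    simp only [θ, LinearMap.comp_apply, LinearEquiv.coe_coe, LinearEquiv.symm_apply_apply]
    rfl
  have hT : Submodule.comap I.subtype (Ideal.span {t} * I) ≤ LinearMap.ker θ := by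
    rintro ⟨x, hx⟩ h
    obtain ⟨y, hy, h⟩ := Ideal.mem_span_singleton_mul.1 h
    have : (⟨x, hx⟩ : I) = t • ⟨y, hy⟩ := Subtype.ext h.symm
    rw [this, LinearMap.mem_ker, map_smul]
    funext i
    obtain ⟨z, hz⟩ := Submodule.mkQ_surjective (IsLocalRing.maximalIdeal R) (θ ⟨y, hy⟩ i)
    rw [Pi.smul_apply, ← hz, ← map_smul]
    exact (Submodule.Quotient.mk_eq_zero _).2 (Ideal.mul_mem_right _ _ htm)
  have hl : Module.length R (Fin (n + 1) → k) ≤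
      Module.length R (I ⧸ Submodule.comap I.subtype (Ideal.span {t} * I)) := by
    refine Module.length_le_of_surjective (Submodule.liftQ _ θ hT) ?_
    intro v
    obtain ⟨w, rfl⟩ := hθ v
    exact ⟨Submodule.Quotient.mk w, rfl⟩
  have hbI : b ^ n ∈ I := by
    refine ⟨Pi.single 0 1, ?_⟩
    simp [φ, Fintype.linearCombination_apply, Pi.single_apply]
  rw [length_IT hdim ht (pow_mem hb n) I hbI, ← hn, Module.length_pi] at hl
  have : IsSimpleModule R k :=
    isSimpleModule_iff_isCoatom.2 (IsLocalRing.maximalIdeal.isMaximal R).out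
  rw [Module.length_eq_one] at hl
  simp at hl
  norm_cast at hl
  omega

end B

section C
variable {K : Type*} [CommRing K]

theorem horner (A : Subring K) (hA : ∀ x : K, IsIntegral A x → x ∈ A) (x : K) :
    ∀ (n : ℕ) (c : ℕ → K), (∀ i, c i ∈ A) → ∑ i ∈ Finset.range (n + 1), c i * x ^ i = 0 →
      ∀ i ≤ n, ∃ u ∈ A, ∃ v ∈ A, u * x ∈ A ∧ v * x ∈ A ∧ c i = u + v * x := by
  intro n
  induction n with
  | zero =>
    intro c hc h i hi
    obtain rfl : i = 0 := by omega
    simp only [zero_add, Finset.range_one, Finset.sum_singleton, pow_zero, mul_one] at h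
    exact ⟨0, A.zero_mem, 0, A.zero_mem, by simp [A.zero_mem], by simp [A.zero_mem], by simp [h]⟩
  | succ n ih =>
    intro c hc h
    have hlead : c (n + 1) * x ∈ A := by
      by_cases h0 : c (n + 1) = 0
      · rw [h0, zero_mul]; exact A.zero_mem
      let p : Polynomial A :=
        ∑ i ∈ Finset.range (n + 1 + 1), Polynomial.monomial i (⟨c i, hc i⟩ : A)
      have hcoeff : p.coeff (n + 1) = ⟨c (n + 1), hc _⟩ := by
        simp [p, Polynomial.finsetSum_coeff, Polynomial.coeff_monomial]
      have hdeg : p.natDegree ≤ n + 1 := by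
        refine Polynomial.natDegree_sum_le_of_forall_le _ _ ?_
        intro i hi
        refine (Polynomial.natDegree_monomial_le _).trans ?_
        have := Finset.mem_range.1 hi
        omega
      have hdeg' : p.natDegree = n + 1 := by
        refine le_antisymm hdeg (Polynomial.le_natDegree_of_ne_zero ?_)
        rw [hcoeff]
        intro h
        exact h0 (congrArg Subtype.val h)
      have hroot : Polynomial.aeval x p = 0 := by
        simp only [p, map_sum, Polynomial.aeval_monomial]
        exact h
      have := hA _ (isIntegral_leadingCoeff_smul p x hroot)
      rwa [Polynomial.leadingCoeff, hdeg', hcoeff] at this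
    have key := ih (Function.update c n (c n + c (n + 1) * x)) (by
      intro i
      by_cases hi : i = n
      · subst hi; simp only [Function.update_self]; exact A.add_mem (hc _) hlead
      · rw [Function.update_of_ne hi]; exact hc i) (by
      rw [Finset.sum_range_succ] at h ⊢
      rw [Finset.sum_range_succ] at h
      rw [← h, Function.update_self]
      have : ∑ i ∈ Finset.range n, Function.update c n (c n + c (n + 1) * x) i * x ^ i =
          ∑ i ∈ Finset.range n, c i * x ^ i := by
        refine Finset.sum_congr rfl ?_
        intro i hi
        rw [Function.update_of_ne (Finset.mem_range.1 hi).ne]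
      rw [this]
      ring)
    intro i hi
    by_cases h1 : i = n + 1
    · subst h1
      exact ⟨c (n + 1), hc _, 0, A.zero_mem, hlead, by simp [A.zero_mem], by simp⟩
    obtain ⟨u, hu, v, hv, hux, hvx, h2⟩ := key i (by omega)
    by_cases h3 : i = n
    · subst h3
      rw [Function.update_self] at h2
      refine ⟨u, hu, v - c (i + 1), A.sub_mem hv (hc _), hux, ?_, ?_⟩
      · rw [sub_mul]; exact A.sub_mem hvx hlead
      · linear_combination h2
    · rw [Function.update_of_ne h3] at h2
      exact ⟨u, hu, v, hv, hux, hvx, h2⟩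

theorem vnr [IsArtinianRing K] [IsReduced K] (x : K) : ∃ w, x = x * (x * w) := by
  obtain ⟨n, y, hy⟩ := IsArtinian.exists_pow_succ_smul_dvd x (1 : K)
  simp only [smul_eq_mul, mul_one] at hy
  refine ⟨y, ?_⟩
  have h : (x * (1 - x * y)) ^ (n + 1) = 0 := by
    have h1 : x ^ n * (1 - x * y) = 0 := by rw [pow_succ] at hy; linear_combination -hy
    calc _ = x * (1 - x * y) ^ n * (x ^ n * (1 - x * y)) := by rw [mul_pow, pow_succ, pow_succ]; ring
      _ = 0 := by rw [h1, mul_zero]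
  have := pow_eq_zero_iff (n := n + 1) (by omega) |>.1 h
  linear_combination this

theorem idem_mem (A : Subring K) (hA : ∀ x : K, IsIntegral A x → x ∈ A) {x w : K}
    (h : x = x * (x * w)) : x * w ∈ A := by
  apply hA
  refine ⟨Polynomial.X ^ 2 - Polynomial.X, ?_, ?_⟩
  · exact Polynomial.monic_X_pow_sub (n := 2) (Polynomial.degree_X_le.trans_lt (by norm_num))
  · simp
    linear_combination (-w) * h

theorem comp_loc (A : Subring K) (hA : ∀ x : K, IsIntegral A x → x ∈ A)
    (hv : ∀ x : K, ∃ w, x = x * (x * w))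
    (hP : ∀ x : K, ∃ u ∈ A, ∃ v ∈ A, u * x ∈ A ∧ v * x ∈ A ∧ 1 = u + v * x)
    (n : Ideal A) [n.IsPrime] (y z : K) :
    ∃ s : A, s ∉ n ∧ ((∃ a : A, s * y = a * z) ∨ (∃ a : A, s * z = a * y)) := by
  obtain ⟨w, hw⟩ := hv z
  have he := idem_mem A hA hw
  have hone : (1 : A) ∉ n := fun h => Ideal.IsPrime.ne_top ‹_› ((Ideal.eq_top_iff_one _).2 h)
  by_cases h1 : (⟨z * w, he⟩ : A) ∈ n
  · refine ⟨1 - ⟨z * w, he⟩, fun h => hone (by simpa using n.add_mem h h1), Or.inr ⟨0, ?_⟩⟩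
    push_cast
    linear_combination hw
  · obtain ⟨u, hu, v, hv, hux, hvx, h⟩ := hP (y * w)
    have huv : (⟨u, hu⟩ : A) ∉ n ∨ (⟨v * (y * w), hvx⟩ : A) ∉ n := by
      by_contra! hh
      apply hone
      convert n.add_mem hh.1 hh.2
      exact Subtype.ext h
    rcases huv with h2 | h2
    · refine ⟨⟨u, hu⟩ * ⟨z * w, he⟩, fun h => (Ideal.IsPrime.mem_or_mem ‹_› h).elim h2 h1,
        Or.inl ⟨⟨u * (y * w), hux⟩, ?_⟩⟩
      push_cast
      ring
    · refine ⟨⟨v * (y * w), hvx⟩, h2, Or.inr ⟨⟨v, hv⟩ * ⟨z * w, he⟩, ?_⟩⟩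
      push_cast
      ring

theorem comp_loc_fin (A : Subring K) (hA : ∀ x : K, IsIntegral A x → x ∈ A)
    (hv : ∀ x : K, ∃ w, x = x * (x * w))
    (hP : ∀ x : K, ∃ u ∈ A, ∃ v ∈ A, u * x ∈ A ∧ v * x ∈ A ∧ 1 = u + v * x)
    (n : Ideal A) [n.IsPrime] (T : Finset K) :
    ∃ s : A, s ∉ n ∧ ∃ x ∈ insert 0 (T : Set K), ∀ y ∈ T, ∃ a : A, s * y = a * x := by
  classical
  have hone : (1 : A) ∉ n := fun h => Ideal.IsPrime.ne_top ‹_› ((Ideal.eq_top_iff_one _).2 h)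
  induction T using Finset.induction_on with
  | empty => exact ⟨1, hone, 0, by simp, by simp⟩
  | insert z T hz ih =>
    obtain ⟨s, hs, x, hx, h⟩ := ih
    obtain ⟨s', hs', h'⟩ := comp_loc A hA hv hP n z x
    have hss : s * s' ∉ n := fun h => (Ideal.IsPrime.mem_or_mem ‹_› h).elim hs hs'
    rcases h' with ⟨a, ha⟩ | ⟨a, ha⟩
    · refine ⟨s * s', hss, x, ?_, ?_⟩
      · simp only [Finset.coe_insert, Set.mem_insert_iff] at hx ⊢
        tauto
      · intro y hy
        rcases Finset.mem_insert.1 hy with rfl | hy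
        · exact ⟨s * a, by push_cast; linear_combination (s : K) * ha⟩
        · obtain ⟨b, hb⟩ := h y hy
          exact ⟨s' * b, by push_cast; linear_combination (s' : K) * hb⟩
    · refine ⟨s * s', hss, z, by simp, ?_⟩
      intro y hy
      rcases Finset.mem_insert.1 hy with rfl | hy
      · exact ⟨s * s', by push_cast; ring⟩
      · obtain ⟨b, hb⟩ := h y hy
        exact ⟨b * a, by push_cast; linear_combination (s' : K) * hb + (b : K) * ha⟩

theorem proj_rank1 (A : Subring K) (hA : ∀ x : K, IsIntegral A x → x ∈ A)
    (hv : ∀ x : K, ∃ w, x = x * (x * w))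
    (hP : ∀ x : K, ∃ u ∈ A, ∃ v ∈ A, u * x ∈ A ∧ v * x ∈ A ∧ 1 = u + v * x)
    (J : Submodule A K) (hJ : J.FG) : Module.Projective A J := by
  classical
  obtain ⟨T, rfl⟩ := hJ
  set J := Submodule.span A (T : Set K)
  apply Module.Projective.of_one_mem_range_dualTensorHom
  let I : Ideal A := Submodule.comap (LinearMap.toSpanSingleton A (Module.End A J) 1)
    (LinearMap.range (dualTensorHom A J J))
  suffices hI : I = ⊤ by
    have : (1 : A) ∈ I := by rw [hI]; trivial
    have h2 : (1 : A) • (1 : Module.End A J) ∈ LinearMap.range (dualTensorHom A J J) := this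
    rwa [one_smul] at h2
  by_contra hI
  obtain ⟨n, hn, hIn⟩ := Ideal.exists_le_maximal I hI
  have := hn.isPrime
  obtain ⟨s, hs, x, hx, h⟩ := comp_loc_fin A hA hv hP n T
  apply hs
  apply hIn
  have hxJ : x ∈ J := by
    rcases hx with rfl | hx
    · exact J.zero_mem
    · exact Submodule.subset_span hx
  have hall : ∀ y ∈ J, ∃ a : A, s * y = a * x := by
    intro y hy
    induction hy using Submodule.span_induction with
    | mem y hy => exact h y hy
    | zero => exact ⟨0, by simp⟩
    | add y z _ _ h1 h2 =>
      obtain ⟨a, ha⟩ := h1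
      obtain ⟨b, hb⟩ := h2
      exact ⟨a + b, by push_cast; linear_combination ha + hb⟩
    | smul r y _ h1 =>
      obtain ⟨a, ha⟩ := h1
      refine ⟨r * a, ?_⟩
      rw [Subring.smul_def, smul_eq_mul]
      push_cast; linear_combination (r : K) * ha
  obtain ⟨w, hw⟩ := hv x
  have he := idem_mem A hA hw
  let φ : J →ₗ[A] A :=
    { toFun := fun y => ⟨s * y * w, by
        obtain ⟨a, ha⟩ := hall y y.2
        rw [ha, mul_assoc]
        exact A.mul_mem a.2 he⟩
      map_add' := fun y z => Subtype.ext (by push_cast; ring)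
      map_smul' := fun r y => Subtype.ext (by
        simp only [Submodule.coe_smul, Subring.smul_def, smul_eq_mul, RingHom.id_apply, Subring.coe_mul]
        ring) }
  refine ⟨φ ⊗ₜ ⟨x, hxJ⟩, ?_⟩
  ext y
  obtain ⟨a, ha⟩ := hall y y.2
  change ((s : K) * y * w) * x = s * y
  linear_combination (w * x - 1) * ha - (a : K) * hw

theorem proj_rankn (A : Subring K) (hA : ∀ x : K, IsIntegral A x → x ∈ A)
    (hv : ∀ x : K, ∃ w, x = x * (x * w))
    (hP : ∀ x : K, ∃ u ∈ A, ∃ v ∈ A, u * x ∈ A ∧ v * x ∈ A ∧ 1 = u + v * x) :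
    ∀ (n : ℕ) (N : Type u) [AddCommGroup N] [Module A N] [Module.Finite A N]
      (f : N →ₗ[A] (Fin n → K)), Function.Injective f → Module.Projective A N := by
  intro n
  induction n with
  | zero =>
    intro N _ _ _ f hf
    have : Subsingleton N := hf.subsingleton
    infer_instance
  | succ n ih =>
    intro N _ _ _ f hf
    let g : N →ₗ[A] K := LinearMap.proj 0 ∘ₗ f
    have hfg : (LinearMap.range g).FG := by
      rw [← Submodule.map_top]
      exact (Module.Finite.fg_top).map g
    have hproj := proj_rank1 A hA hv hP _ hfg
    obtain ⟨σ, hσ⟩ := g.rangeRestrict.exists_rightInverse_of_surjective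
      (LinearMap.range_rangeRestrict g)
    let k := LinearMap.ker g
    have hσ' : ∀ y, g (σ y) = y := fun y => congrArg Subtype.val (LinearMap.congr_fun hσ y)
    let π : N →ₗ[A] k := LinearMap.codRestrict k (LinearMap.id - σ ∘ₗ g.rangeRestrict) (by
      intro y
      rw [LinearMap.mem_ker]
      simp [hσ'])
    have hπ : ∀ y : k, π y = y := by
      intro y
      have hy : g.rangeRestrict y = 0 := Subtype.ext y.2
      apply Subtype.ext
      simp [π, hy]
    have : Module.Finite A k := Module.Finite.of_surjective π (fun y => ⟨y, hπ y⟩)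
    have hk : Module.Projective A k := by
      refine ih k (LinearMap.funLeft A K Fin.succ ∘ₗ f ∘ₗ k.subtype) ?_
      intro y z hyz
      apply Subtype.ext
      apply hf
      funext i
      refine Fin.cases ?_ ?_ i
      · have h1 : f y 0 = 0 := y.2
        have h2 : f z 0 = 0 := z.2
        exact h1.trans h2.symm
      · intro i
        exact congrFun hyz i
    refine Module.Projective.of_split (M := k × LinearMap.range g) (π.prod g.rangeRestrict)
      (LinearMap.coprod k.subtype σ) ?_
    ext y
    simp [π]

end C

section D
variable {R : Type u} [CommRing R]

theorem intcl (K : Type*) [CommRing K] [Algebra R K] (x : K)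
    (hx : IsIntegral (integralClosure R K).toSubring x) : x ∈ (integralClosure R K).toSubring := by
  have : IsIntegral R x := isIntegral_trans (R := R) (A := integralClosure R K) x hx
  exact this

theorem propP [IsNoetherianRing R] [IsReduced R] [IsLocalRing R] (hdim : ringKrullDim R = 1)
    (K : Type*) [CommRing K] [Algebra R K] [IsFractionRing R K] (x : K) :
    ∃ u ∈ (integralClosure R K).toSubring, ∃ v ∈ (integralClosure R K).toSubring,
      u * x ∈ (integralClosure R K).toSubring ∧ v * x ∈ (integralClosure R K).toSubring ∧
      1 = u + v * x := by
  set A := (integralClosure R K).toSubring with hAdef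
  have hRA : ∀ r : R, algebraMap R K r ∈ A := fun r => isIntegral_algebraMap
  obtain ⟨⟨a, b⟩, hab⟩ := IsLocalization.surj (nonZeroDivisors R) x
  simp only at hab
  obtain ⟨n, c, ⟨j, hj⟩, hc⟩ := exists_rel hdim a b b.2
  have hbu : IsUnit (algebraMap R K b) := IsLocalization.map_units K b
  let c' : ℕ → K := fun i => if h : i < n + 1 then algebraMap R K (c ⟨i, h⟩) else 0
  have hc' : ∀ i, c' i ∈ A := by
    intro i
    simp only [c']
    split
    · exact hRA _
    · exact A.zero_mem
  have hsum : ∑ i ∈ Finset.range (n + 1), c' i * x ^ i = 0 := by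
    rw [← (hbu.pow n).mul_left_eq_zero, ← map_zero (algebraMap R K), ← hc, Finset.sum_mul,
      Finset.sum_range, map_sum]
    refine Finset.sum_congr rfl ?_
    intro i _
    have hi : (i : ℕ) ≤ n := by omega
    simp only [c', i.2, dif_pos, map_mul, map_pow, ← hab]
    have hbn : (algebraMap R K b) ^ n =
        (algebraMap R K b) ^ (i : ℕ) * (algebraMap R K b) ^ (n - (i : ℕ)) := by
      rw [← pow_add, Nat.add_sub_cancel' hi]
    rw [hbn, mul_pow]
    ring
  obtain ⟨u, hu, v, hv, hux, hvx, h⟩ := horner A (intcl K) x n c' hc' hsum j (by omega)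
  obtain ⟨d, hd⟩ := hj.exists_right_inv
  have hcd : c' j * algebraMap R K d = 1 := by
    simp only [c', j.2, dif_pos]
    rw [← map_mul, hd, map_one]
  refine ⟨algebraMap R K d * u, A.mul_mem (hRA d) hu, algebraMap R K d * v,
    A.mul_mem (hRA d) hv, ?_, ?_, ?_⟩
  · rw [mul_assoc]; exact A.mul_mem (hRA d) hux
  · rw [mul_assoc]; exact A.mul_mem (hRA d) hvx
  · rw [← hcd, h]; ring

theorem embed [IsNoetherianRing R] [IsReduced R] [Nontrivial R] (M : Type u) [AddCommGroup M] [Module R M]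
    [Module.Finite R M] (hM : Submodule.torsion R M = ⊥) :
    ∃ (n : ℕ) (ι : M →ₗ[R] (Fin n → Localization (nonZeroDivisors R))), Function.Injective ι := by
  let K := Localization (nonZeroDivisors R)
  have : IsArtinianRing K := art_Q (R := R) K
  have : IsReduced K := isReduced_localizationPreserves (nonZeroDivisors R) K inferInstance
  have : IsSemisimpleRing K := IsArtinianRing.isSemisimpleRing_of_isReduced K
  let L := LocalizedModule (nonZeroDivisors R) M
  have : Module.Finite K L :=
    Module.Finite.of_isLocalizedModule (nonZeroDivisors R) (LocalizedModule.mkLinearMap (nonZeroDivisors R) M)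
  obtain ⟨n, f, hf⟩ := Module.Finite.exists_fin' K L
  have : Module.Projective K L := Module.projective_of_isSemisimpleRing K L
  obtain ⟨g, hg⟩ := f.exists_rightInverse_of_surjective (LinearMap.range_eq_top.2 hf)
  refine ⟨n, (g.restrictScalars R) ∘ₗ (LocalizedModule.mkLinearMap (nonZeroDivisors R) M), ?_⟩
  have hginj : Function.Injective g := Function.LeftInverse.injective (g := f) (LinearMap.congr_fun hg)
  refine hginj.comp ?_
  rw [← LinearMap.ker_eq_bot, LinearMap.ker_eq_bot']
  intro m hm
  rw [IsLocalizedModule.eq_zero_iff (nonZeroDivisors R)] at hm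
  obtain ⟨s, hs⟩ := hm
  have : m ∈ Submodule.torsion R M := (Submodule.mem_torsion_iff m).2 ⟨s, hs⟩
  rwa [hM] at this

theorem factor_free [IsNoetherianRing R] [IsReduced R] [IsLocalRing R] (hdim : ringKrullDim R = 1)
    (M : Type u) [AddCommGroup M] [Module R M]
    [Module.Finite R M] (hM : Submodule.torsion R M = ⊥) (c : R) (hc : c ∈ conductorIdeal R) :
    ∃ (k : ℕ) (α : M →ₗ[R] (Fin k → R)) (β : (Fin k → R) →ₗ[R] M), ∀ m, β (α m) = c • m := by
  let K := Localization (nonZeroDivisors R)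
  let A := (integralClosure R K).toSubring
  have hRA : ∀ r : R, algebraMap R K r ∈ A := fun r => isIntegral_algebraMap
  have : IsArtinianRing K := art_Q (R := R) K
  have : IsReduced K := isReduced_localizationPreserves (nonZeroDivisors R) K inferInstance
  have hinj : Function.Injective (algebraMap R K) := IsFractionRing.injective R K
  have hcA : ∀ a : A, ∃ r : R, algebraMap R K r = algebraMap R K c * a := by
    intro a
    have h1 := Submodule.mem_div_iff_forall_mul_mem.1 (Submodule.mem_comap.1 hc) a a.2
    exact Submodule.mem_one.1 h1
  choose ρ hρ using hcA
  obtain ⟨n, ι, hι⟩ := embed M hM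
  obtain ⟨k, p, hp⟩ := Module.Finite.exists_fin' R M
  let q : (Fin k → A) →ₗ[A] (Fin n → K) :=
    Fintype.linearCombination A (fun j => ι (p (Pi.single j 1)))
  have hsingle : ∀ r : Fin k → R, ι (p r) = ∑ j, algebraMap R K (r j) • ι (p (Pi.single j 1)) := by
    intro r
    conv_lhs => rw [pi_eq_sum_univ' r]
    rw [map_sum, map_sum]
    refine Finset.sum_congr rfl fun j _ => ?_
    rw [map_smul, map_smul, algebraMap_smul]
  have hq : ∀ a : Fin k → A, q a = ∑ j, (a j : K) • ι (p (Pi.single j 1)) := by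
    intro a
    rfl
  have hmem : ∀ m, ι m ∈ LinearMap.range q := by
    intro m
    obtain ⟨r, rfl⟩ := hp m
    exact ⟨fun j => ⟨algebraMap R K (r j), hRA _⟩, by rw [hq, hsingle]⟩
  have hproj : Module.Projective A (LinearMap.range q) :=
    proj_rankn A (intcl K) vnr (propP hdim K) n _ (LinearMap.range q).subtype
      Subtype.val_injective
  obtain ⟨σ, hσ⟩ := q.rangeRestrict.exists_rightInverse_of_surjective
    (LinearMap.range_rangeRestrict q)
  have hσ' : ∀ y, q (σ y) = y := fun y => congrArg Subtype.val (LinearMap.congr_fun hσ y)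
  let α : M →ₗ[R] (Fin k → R) :=
    { toFun := fun m j => ρ (σ ⟨ι m, hmem m⟩ j)
      map_add' := by
        intro x y
        funext j
        apply hinj
        have : (⟨ι (x + y), hmem _⟩ : LinearMap.range q) = ⟨ι x, hmem x⟩ + ⟨ι y, hmem y⟩ :=
          Subtype.ext (map_add ι x y)
        rw [this, map_add, Pi.add_apply, Pi.add_apply, map_add, hρ, hρ, hρ]
        push_cast
        ring
      map_smul' := by
        intro r x
        funext j
        apply hinj
        have : (⟨ι (r • x), hmem _⟩ : LinearMap.range q) =
            (⟨algebraMap R K r, hRA r⟩ : A) • ⟨ι x, hmem x⟩ :=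
          Subtype.ext ((map_smul ι r x).trans (algebraMap_smul K r (ι x)).symm)
        rw [this, map_smul, Pi.smul_apply, hρ]
        simp only [RingHom.id_apply, Pi.smul_apply, smul_eq_mul, map_mul, hρ, Subring.coe_mul]
        ring }
  refine ⟨k, α, p, fun m => hι ?_⟩
  rw [hsingle]
  have h1 : ∀ j, algebraMap R K (α m j) = algebraMap R K c * σ ⟨ι m, hmem m⟩ j := fun j => hρ _
  simp only [h1, mul_smul]
  rw [← Finset.smul_sum, ← hq, hσ', map_smul, algebraMap_smul]

end D

/-- Let `(R, 𝔪)` be a one-dimensional Noetherian local ring whose `𝔪`-adic completion is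
reduced.  Then the conductor `𝒞(R)` annihilates `Ext^i_R(M, N)` and `Tor_i^R(M, N)` for every
`i ≥ 1`, every finitely generated torsion-free `R`-module `M`, and every (not necessarily
finitely generated) `R`-module `N`. -/
theorem conductor_ann_ext_tor (R : Type u) [CommRing R] [IsNoetherianRing R]
    [IsLocalRing R] (hdim : ringKrullDim R = 1)
    (hred : IsReduced (AdicCompletion (IsLocalRing.maximalIdeal R) R)) :
    ∀ (i : ℕ), 1 ≤ i →
      ∀ (M : ModuleCat.{u} R), Module.Finite R M → Submodule.torsion R M = ⊥ →
        ∀ (N : ModuleCat.{u} R),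
          conductorIdeal R ≤
            Module.annihilator R (((Ext R (ModuleCat.{u} R) i).obj (op M)).obj N) ∧
          conductorIdeal R ≤
            Module.annihilator R (((Tor (ModuleCat.{u} R) i).obj M).obj N) := by
  have := red_of_compl hred
  intro i hi M hfin hM N
  obtain ⟨n, rfl⟩ : ∃ n, i = n + 1 := ⟨i - 1, by omega⟩
  have key : ∀ c ∈ conductorIdeal R, ∃ (P : ModuleCat.{u} R) (_ : Projective P)
      (_ : Module.Flat R P) (a : M ⟶ P) (b : P ⟶ M), a ≫ b = c • 𝟙 M := by
    intro c hc
    obtain ⟨k, α, β, h⟩ := factor_free hdim M hM c hc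
    refine ⟨ModuleCat.of R (Fin k → R), ?_, ?_, ModuleCat.ofHom α, ModuleCat.ofHom β, ?_⟩
    · exact (IsProjective.iff_projective (R := R) (Fin k → R)).1 inferInstance
    · change Module.Flat R (Fin k → R)
      infer_instance
    · ext m
      exact h m
  constructor
  · intro c hc
    obtain ⟨P, _, _, a, b, h⟩ := key c hc
    exact ext_kill c M P N a b h n
  · intro c hc
    obtain ⟨P, _, _, a, b, h⟩ := key c hc
    exact tor_kill c M P N a b h n
end

section
/- Let (R, 𝔪) be a one-dimensional Gorenstein Noetherian local ring (a Cohen–Macaulay local ring of Krull dimension one that has finite injective dimension, equivalently injective dimension at most 1, as a module over itself) whose 𝔪-adic completion is reduced. Then for every integer n ≥ 2, the ideal ⋂_{i ≥ n} ⋂_{M, N finitely generated R-modules} ann_R Ext^i_R(M, N) equals the conductor 𝒞(R); consequently the cohomology annihilator ca(R) = ⋃_{n ≥ 1} ⋂_{i ≥ n, M, N finitely generated} ann_R Ext^i_R(M, N) equals 𝒞(R). -/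
open CategoryTheory Opposite

universe u

/-- The `n`-th cohomology annihilator of Iyengar–Takahashi:
`ca^n(R) = ⋂_{i ≥ n, M, N finitely generated R-modules} ann_R Ext^i_R(M, N)`. -/
noncomputable def cohomologyAnnihilator (R : Type u) [CommRing R] (n : ℕ) : Ideal R :=
  ⨅ (i : ℕ) (_ : n ≤ i)
    (M : ModuleCat.{u} R) (_ : Module.Finite R M)
    (N : ModuleCat.{u} R) (_ : Module.Finite R N),
    Module.annihilator R (((Ext R (ModuleCat.{u} R) i).obj (op M)).obj N)


theorem sc_ann_aux {R : Type u} [CommRing R] (S : ShortComplex (ModuleCat.{u} R)) (r : R) :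
    r ∈ Module.annihilator R S.homology ↔ ∀ x : S.X₂, S.g x = 0 → ∃ y : S.X₁, S.f y = r • x := by
  let e : S.homology ≅ ModuleCat.of R (LinearMap.ker S.g.hom ⧸ LinearMap.range S.moduleCatToCycles) :=
      S.moduleCatHomologyIso
  rw [e.toLinearEquiv.annihilator_eq, Module.mem_annihilator]
  constructor
  · intro h f hf
    have := h (Submodule.Quotient.mk ⟨f, hf⟩)
    rw [← Submodule.Quotient.mk_smul, Submodule.Quotient.mk_eq_zero] at this
    obtain ⟨g, hg⟩ := this
    exact ⟨g, congrArg Subtype.val hg⟩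
  · intro h m
    obtain ⟨⟨f, hf⟩, rfl⟩ := Submodule.Quotient.mk_surjective _ m
    obtain ⟨g, hg⟩ := h f hf
    rw [← Submodule.Quotient.mk_smul, Submodule.Quotient.mk_eq_zero]
    exact ⟨g, Subtype.ext hg⟩

theorem ext_ann_aux {R : Type u} [CommRing R] {X Y : ModuleCat.{u} R} (P : ProjectiveResolution X)
    (n : ℕ) (r : R) :
    r ∈ Module.annihilator R (((Ext R (ModuleCat.{u} R) (n+1)).obj (op X)).obj Y) ↔
    ∀ f : P.complex.X (n+1) ⟶ Y, P.complex.d (n+2) (n+1) ≫ f = 0 →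
      ∃ g : P.complex.X n ⟶ Y, P.complex.d (n+1) n ≫ g = r • f := by
  let K := P.complex.linearYonedaObj R Y
  let S := K.sc' n (n+1) (n+2)
  let e : (((Ext R (ModuleCat.{u} R) (n+1)).obj (op X)).obj Y) ≅ S.homology :=
    P.isoExt (n+1) Y ≪≫ K.homologyIsoSc' n (n+1) (n+2) (by simp) (by simp)
  rw [e.toLinearEquiv.annihilator_eq, sc_ann_aux]
  exact Iff.rfl

theorem ext_ann_iff {R : Type u} [CommRing R] (X Y : ModuleCat.{u} R) (n : ℕ) (r : R) :
    r ∈ Module.annihilator R (((Ext R (ModuleCat.{u} R) (n+1)).obj (op X)).obj Y) ↔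
    ∀ e : Abelian.Ext.{u} X Y (n+1), r • e = 0 := by
  let P := projectiveResolution X
  rw [ext_ann_aux P]
  constructor
  · intro h e
    obtain ⟨f, hf, rfl⟩ := P.extMk_surjective e (n+2) rfl
    rw [Abelian.Ext.smul_eq_comp_mk₀, P.extMk_comp_mk₀, P.extMk_eq_zero_iff _ _ _ _ n rfl]
    obtain ⟨g, hg⟩ := h f hf
    exact ⟨g, by simpa using hg⟩
  · intro h f hf
    have := h (P.extMk f (n+2) rfl hf)
    rw [Abelian.Ext.smul_eq_comp_mk₀, P.extMk_comp_mk₀, P.extMk_eq_zero_iff _ _ _ _ n rfl] at this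
    obtain ⟨g, hg⟩ := this
    exact ⟨g, by simpa using hg⟩

/-- `r` kills `Ext^{n+1}(M, N)`. -/
def Ek {R : Type u} [CommRing R] (r : R) (n : ℕ) (M N : Type u) [AddCommGroup M] [Module R M]
    [AddCommGroup N] [Module R N] : Prop :=
  ∀ e : Abelian.Ext.{u} (ModuleCat.of R M) (ModuleCat.of R N) (n+1), r • e = 0

section
variable {R : Type u} [CommRing R] {r : R} {n : ℕ} {K P M N : Type u}
    [AddCommGroup K] [Module R K] [AddCommGroup P] [Module R P]
    [AddCommGroup M] [Module R M] [AddCommGroup N] [Module R N]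

theorem ses_mk {i : K →ₗ[R] P} {p : P →ₗ[R] M} (hi : Function.Injective i)
    (hp : Function.Surjective p) (hip : Function.Exact i p) :
    (ModuleCat.shortComplexOfCompEqZero i p hip.linearMap_comp_eq_zero).ShortExact :=
  ModuleCat.shortComplex_shortExact _ hip hi hp

theorem Ek_up [Module.Projective R P] {i : K →ₗ[R] P} {p : P →ₗ[R] M} (hi : Function.Injective i)
    (hp : Function.Surjective p) (hip : Function.Exact i p) (h : Ek r n K N) :
    Ek r (n+1) M N := by
  intro e
  have hS := ses_mk hi hp hip
  have : Projective (ModuleCat.of R P) := ModuleCat.projective_of_categoryTheory_projective _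
  obtain ⟨x, rfl⟩ := Abelian.Ext.contravariant_sequence_exact₃ hS _ e
    (Abelian.Ext.eq_zero_of_projective (P := ModuleCat.of R P) _) (add_comm 1 (n+1))
  rw [← Abelian.Ext.comp_smul]
  erw [h x]
  simp

theorem Ek_down [Module.Projective R P] {i : K →ₗ[R] P} {p : P →ₗ[R] M}
    (hi : Function.Injective i)
    (hp : Function.Surjective p) (hip : Function.Exact i p) (h : Ek r (n+1) M N) :
    Ek r n K N := by
  intro x
  have hS := ses_mk hi hp hip
  have := h (hS.extClass.comp x (add_comm 1 (n+1)))
  rw [← Abelian.Ext.comp_smul] at this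
  obtain ⟨y, hy⟩ := Abelian.Ext.contravariant_sequence_exact₁ hS _ _ _ this
  rw [← hy, Abelian.Ext.eq_zero_of_projective (P := ModuleCat.of R P) y]
  simp

theorem Ek_of_factor [Module.Projective R P] {p : P →ₗ[R] M} (s : M →ₗ[R] P)
    (h : ∀ m, p (s m) = r • m) : Ek r n M N := by
  intro x
  have h1 : r • 𝟙 (ModuleCat.of R M) = ModuleCat.ofHom s ≫ ModuleCat.ofHom p := by
    ext m; exact (h m).symm
  have h2 : r • x = (Abelian.Ext.mk₀ (r • 𝟙 (ModuleCat.of R M))).comp x (zero_add _) := by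
    rw [Abelian.Ext.mk₀_smul, Abelian.Ext.smul_comp, Abelian.Ext.mk₀_id_comp]
  rw [h2, h1, ← Abelian.Ext.mk₀_comp_mk₀_assoc, 
    Abelian.Ext.eq_zero_of_projective (P := ModuleCat.of R P) (Abelian.Ext.comp _ x _)]
  simp

theorem factor_of_Ek {i : K →ₗ[R] P} {p : P →ₗ[R] M}
    (hi : Function.Injective i)
    (hp : Function.Surjective p) (hip : Function.Exact i p) (h : Ek r 0 M K) :
    ∃ s : M →ₗ[R] P, ∀ m, p (s m) = r • m := by
  have hS := ses_mk hi hp hip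
  have := h hS.extClass
  obtain ⟨y, hy⟩ := Abelian.Ext.covariant_sequence_exact₃ (ModuleCat.of R M) hS 
    (Abelian.Ext.mk₀ (r • 𝟙 (ModuleCat.of R M))) (n₁ := 1) rfl (by
      rw [Abelian.Ext.mk₀_smul, Abelian.Ext.smul_comp, Abelian.Ext.mk₀_id_comp]; exact this)
  obtain ⟨s, rfl⟩ := Abelian.Ext.addEquiv₀.symm.surjective y
  rw [Abelian.Ext.addEquiv₀_symm_apply, Abelian.Ext.mk₀_comp_mk₀] at hy
  have := (Abelian.Ext.mk₀_bijective _ _).1 hy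
  exact ⟨s.hom, fun m => congrArg (fun f => f.hom m) this⟩

theorem extend_of_Ek {i : K →ₗ[R] P} {p : P →ₗ[R] M}
    (hi : Function.Injective i)
    (hp : Function.Surjective p) (hip : Function.Exact i p) (h : Ek (1 : R) 0 M N)
    (f : K →ₗ[R] N) :
    ∃ s : P →ₗ[R] N, ∀ k, s (i k) = f k := by
  have hS := ses_mk hi hp hip
  obtain ⟨y, hy⟩ := Abelian.Ext.contravariant_sequence_exact₁ hS (ModuleCat.of R N)
    (Abelian.Ext.mk₀ (ModuleCat.ofHom f)) (n₁ := 1) rfl (by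
      rw [← one_smul R (Abelian.Ext.comp _ _ _)]; exact h _)
  obtain ⟨s, rfl⟩ := Abelian.Ext.addEquiv₀.symm.surjective y
  rw [Abelian.Ext.addEquiv₀_symm_apply, Abelian.Ext.mk₀_comp_mk₀] at hy
  have := (Abelian.Ext.mk₀_bijective _ _).1 hy
  exact ⟨s.hom, fun m => congrArg (fun f => f.hom m) this⟩
end

section gor
variable {R : Type u} [CommRing R]

/-- Finitely generated torsionless modules. -/
def TL (R : Type u) [CommRing R] (M : Type u) [AddCommGroup M] [Module R M] : Prop :=
  Module.Finite R M ∧ ∃ (n : ℕ) (f : M →ₗ[R] (Fin n → R)), Function.Injective f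

theorem TL_submodule [IsNoetherianRing R] {n : ℕ} (K : Submodule R (Fin n → R)) : TL R K :=
  ⟨inferInstance, n, K.subtype, K.injective_subtype⟩

variable {M N : Type u} [AddCommGroup M] [Module R M] [AddCommGroup N] [Module R N]

theorem TL_ext_one (G : ∀ (X : Type u) [AddCommGroup X] [Module R X], Ek (1 : R) 1 X R)
    (hM : TL R M) : Ek (1 : R) 0 M R := by
  obtain ⟨_, n, f, hf⟩ := hM
  exact Ek_down (M := (Fin n → R) ⧸ LinearMap.range f) hf (Submodule.mkQ_surjective _)
    (LinearMap.exact_map_mkQ_range f) (G _)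

/-- dual of a presentation -/
def dualPres {l : ℕ} (p : (Fin l → R) →ₗ[R] M) : Module.Dual R M →ₗ[R] (Fin l → R) where
  toFun f := fun i => f (p (Pi.single i 1))
  map_add' _ _ := rfl
  map_smul' _ _ := rfl

theorem dualPres_inj {l : ℕ} (p : (Fin l → R) →ₗ[R] M) (hp : Function.Surjective p) :
    Function.Injective (dualPres p) := by
  intro f g h
  have : f ∘ₗ p = g ∘ₗ p := by
    ext i
    exact congrFun h i
  exact (LinearMap.cancel_right hp).1 this

theorem dualPres_exact [IsNoetherianRing R] {l : ℕ} (p : (Fin l → R) →ₗ[R] M)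
    (hp : Function.Surjective p) :
    ∃ (t : ℕ) (q : (Fin l → R) →ₗ[R] (Fin t → R)), Function.Exact (dualPres p) q := by
  obtain ⟨t, g, hg⟩ := Module.Finite.exists_fin' R (LinearMap.ker p)
  let B : (Fin l → R) →ₗ[R] Module.Dual R (Fin l → R) := (dotProductBilin R R)
  let q : (Fin l → R) →ₗ[R] (Fin t → R) :=
    LinearMap.pi fun s => (LinearMap.applyₗ (g (Pi.single s 1)).1) ∘ₗ B
  have hq : ∀ x s, q x s = x ⬝ᵥ (g (Pi.single s 1)).1 := fun x s => rfl
  have hB : ∀ x i, B x (Pi.single i 1) = x i := fun x i => by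
    change x ⬝ᵥ _ = _; simp
  refine ⟨t, q, fun x => ⟨fun hx => ?_, ?_⟩⟩
  · have h1 : LinearMap.ker p ≤ LinearMap.ker (B x) := by
      intro v hv
      obtain ⟨w, hw⟩ := hg ⟨v, hv⟩
      have : (B x ∘ₗ (LinearMap.ker p).subtype ∘ₗ g) = 0 := by
        ext s
        exact congrFun hx s
      have := LinearMap.congr_fun this w
      simpa [hw] using this
    let e := p.quotKerEquivOfSurjective hp
    refine ⟨(LinearMap.ker p).liftQ (B x) h1 ∘ₗ e.symm.toLinearMap, ?_⟩
    ext i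
    change (LinearMap.ker p).liftQ (B x) h1 (e.symm (p (Pi.single i 1))) = x i
    have : e.symm (p (Pi.single i 1)) = Submodule.Quotient.mk (Pi.single i 1) := by
      rw [LinearEquiv.symm_apply_eq]; rfl
    rw [this, Submodule.liftQ_apply, hB]
  · rintro ⟨f, rfl⟩
    ext s
    have h2 : B (dualPres p f) = f ∘ₗ p := by
      ext i
      simp only [LinearMap.comp_apply, LinearMap.coe_single, hB]
      rfl
    change B (dualPres p f) (g (Pi.single s 1)).1 = 0
    rw [h2, LinearMap.comp_apply, LinearMap.mem_ker.1 (g (Pi.single s 1)).2, map_zero]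

theorem TL_reflexive [IsNoetherianRing R]
    (G : ∀ (X : Type u) [AddCommGroup X] [Module R X], Ek (1 : R) 1 X R)
    [Module.Finite R M] : Function.Surjective (Module.Dual.eval R M) := by
  intro φ
  obtain ⟨l, p, hp⟩ := Module.Finite.exists_fin' R M
  obtain ⟨t, q, hq⟩ := dualPres_exact p hp
  have hq' : Function.Exact (dualPres p) q.rangeRestrict := fun x => by
    rw [← hq x, Subtype.ext_iff]; rfl
  obtain ⟨s, hs⟩ := extend_of_Ek (dualPres_inj p hp) q.surjective_rangeRestrict hq'
    (TL_ext_one G (TL_submodule _)) φ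
  refine ⟨p (fun i => s (Pi.single i 1)), ?_⟩
  ext f
  rw [← hs f, Module.Dual.eval_apply]
  have h1 : ∀ x : Fin l → R, x = ∑ i, x i • Pi.single i (1 : R) := fun x => by
    ext j; simp [Finset.sum_apply, Pi.single_apply]
  rw [h1 (dualPres p f), h1 (fun i => s (Pi.single i 1))]
  simp only [map_sum, map_smul, smul_eq_mul]
  exact Finset.sum_congr rfl fun i _ => mul_comm _ _

theorem TL_cosyzygy [IsNoetherianRing R]
    (G : ∀ (X : Type u) [AddCommGroup X] [Module R X], Ek (1 : R) 1 X R)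
    (hM : TL R M) : ∃ (k t : ℕ) (j : M →ₗ[R] (Fin k → R)) (q : (Fin k → R) →ₗ[R] (Fin t → R)),
      Function.Injective j ∧ Function.Exact j q := by
  obtain ⟨_, n, f, hf⟩ := hM
  have : Module.Finite R (Module.Dual R M) := by
    obtain ⟨l, p, hp⟩ := Module.Finite.exists_fin' R M
    exact Module.Finite.of_injective _ (dualPres_inj p hp)
  obtain ⟨k, p, hp⟩ := Module.Finite.exists_fin' R (Module.Dual R M)
  obtain ⟨t, q, hq⟩ := dualPres_exact p hp
  refine ⟨k, t, dualPres p ∘ₗ Module.Dual.eval R M, q, ?_, ?_⟩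
  · rw [LinearMap.coe_comp]
    refine (dualPres_inj p hp).comp ?_
    intro x y hxy
    apply hf
    ext i
    exact LinearMap.congr_fun hxy (LinearMap.proj i ∘ₗ f)
  · intro x
    rw [hq x]
    constructor
    · rintro ⟨φ, rfl⟩
      obtain ⟨m, rfl⟩ := TL_reflexive G φ
      exact ⟨m, rfl⟩
    · rintro ⟨m, rfl⟩
      exact ⟨Module.Dual.eval R M m, rfl⟩

theorem TL_descend [IsNoetherianRing R]
    (G : ∀ (X : Type u) [AddCommGroup X] [Module R X], Ek (1 : R) 1 X R) (r : R) (n : ℕ)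
    (h : ∀ (M N : Type u) [AddCommGroup M] [Module R M] [AddCommGroup N] [Module R N],
      TL R M → Module.Finite R N → Ek r n M N) :
    ∀ (M N : Type u) [AddCommGroup M] [Module R M] [AddCommGroup N] [Module R N],
      TL R M → Module.Finite R N → Ek r 0 M N := by
  induction n with
  | zero => exact h
  | succ n ih =>
    apply ih
    intro M N _ _ _ _ hM hN
    obtain ⟨k, t, j, q, hj, hq⟩ := TL_cosyzygy G hM
    have hq' : Function.Exact j q.rangeRestrict := fun x => by
      rw [← hq x, Subtype.ext_iff]; rfl
    exact Ek_down hj q.surjective_rangeRestrict hq' (h _ _ (TL_submodule _) hN)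

theorem mem_conductor_of_Ek [IsNoetherianRing R] (r : R)
    (h : ∀ (M N : Type u) [AddCommGroup M] [Module R M] [AddCommGroup N] [Module R N],
      TL R M → Module.Finite R N → Ek r 0 M N) : r ∈ conductorIdeal R := by
  set Q := Localization (nonZeroDivisors R) with hQ
  have hinj : Function.Injective (algebraMap R Q) := IsLocalization.injective Q le_rfl
  rw [conductorIdeal, Submodule.mem_comap, Submodule.mem_div_iff_forall_mul_mem]
  intro a ha
  let S := Subalgebra.toSubmodule (Algebra.adjoin R {a})
  have hSfg : S.FG := IsIntegral.fg_adjoin_singleton ha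
  have hfin : Module.Finite R S := Module.Finite.iff_fg.2 hSfg
  have hTL : TL R S := by
    refine ⟨hfin, ?_⟩
    obtain ⟨T, hT⟩ := hSfg
    obtain ⟨b, hb⟩ := IsLocalization.exist_integer_multiples_of_finset (nonZeroDivisors R) T
    have h1 : ∀ s : S, (b : R) • (s : Q) ∈ LinearMap.range (Algebra.linearMap R Q) := by
      intro s
      have : S ≤ Submodule.comap (LinearMap.lsmul R Q (b : R))
          (LinearMap.range (Algebra.linearMap R Q)) := by
        rw [← hT, Submodule.span_le]
        intro x hx
        obtain ⟨y, hy⟩ := hb x hx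
        exact ⟨y, hy⟩
      exact this s.2
    let e := LinearEquiv.ofInjective (Algebra.linearMap R Q) hinj
    let g : S →ₗ[R] R := e.symm.toLinearMap ∘ₗ
      LinearMap.codRestrict _ (LinearMap.lsmul R Q (b : R) ∘ₗ S.subtype) h1
    have hg : Function.Injective g := by
      refine e.symm.injective.comp ?_
      intro x y hxy
      have h2 : (b : R) • (x : Q) = (b : R) • (y : Q) := congrArg Subtype.val hxy
      have h3 : IsUnit (algebraMap R Q b) := IsLocalization.map_units Q b
      rw [Algebra.smul_def, Algebra.smul_def] at h2
      exact Subtype.ext (h3.mul_left_cancel h2)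
    refine ⟨1, LinearMap.pi fun _ => g, fun x y hxy => hg (congrFun hxy 0)⟩
  obtain ⟨k, p, hp⟩ := Module.Finite.exists_fin' R S
  obtain ⟨s, hs⟩ := factor_of_Ek (LinearMap.ker p).injective_subtype hp
    (LinearMap.exact_subtype_ker_map p) (h S (LinearMap.ker p) hTL inferInstance)
  have key : ∀ (i : Fin k) (x : S), algebraMap R Q (s x i) =
      (x : Q) * algebraMap R Q (s ⟨1, one_mem (Algebra.adjoin R {a})⟩ i) := by
    intro i x
    obtain ⟨⟨z, y⟩, hzy⟩ := IsLocalization.surj (nonZeroDivisors R) (x : Q)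
    simp only at hzy
    have h3 : IsUnit (algebraMap R Q y) := IsLocalization.map_units Q y
    apply h3.mul_left_cancel
    have h4 : (y : R) • x = z • (⟨1, one_mem (Algebra.adjoin R {a})⟩ : S) := by
      apply Subtype.ext
      change (y : R) • (x : Q) = z • (1 : Q)
      rw [Algebra.smul_def, Algebra.smul_def, mul_one, mul_comm, hzy]
    have h5 := congrFun (congrArg s h4) i
    rw [map_smul, map_smul, Pi.smul_apply, Pi.smul_apply, smul_eq_mul, smul_eq_mul] at h5
    rw [← map_mul, h5, map_mul, ← hzy]; ring
  have h6 := congrArg Subtype.val (hs ⟨1, one_mem (Algebra.adjoin R {a})⟩)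
  set w := s ⟨1, one_mem (Algebra.adjoin R {a})⟩
  have h1 : w = ∑ i, w i • Pi.single i (1 : R) := by
    ext j; simp [Finset.sum_apply, Pi.single_apply]
  rw [h1, map_sum] at h6
  have h7 : algebraMap R Q r = ∑ i, algebraMap R Q (w i) * (p (Pi.single i 1) : Q) := by
    have : algebraMap R Q r = r • (1 : Q) := by rw [Algebra.smul_def, mul_one]
    rw [this]
    refine Eq.trans h6.symm ?_
    rw [AddSubmonoidClass.coe_finsetSum]
    refine Finset.sum_congr rfl fun i _ => ?_
    rw [map_smul, ← Algebra.smul_def]; rfl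
  rw [Submodule.mem_one]
  have ha' : ∀ x : S, (x : Q) * a ∈ S := fun x =>
    (Algebra.adjoin R {a}).mul_mem x.2 (Algebra.self_mem_adjoin_singleton R a)
  refine ⟨∑ i, s ⟨_, ha' (p (Pi.single i 1))⟩ i, ?_⟩
  rw [map_sum, Algebra.linearMap_apply, h7, Finset.sum_mul]
  refine Finset.sum_congr rfl fun i _ => ?_
  rw [key]; simp only [w]; ring
end gor

section key
variable {R : Type u} [CommRing R] [IsNoetherianRing R]

theorem dedekind_aux (hd : Ring.KrullDimLE 1 R) (K : Type u) [Field K] [Algebra R K]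
    (hfrac : ∀ x : K, ∃ a b : R, algebraMap R K b ≠ 0 ∧ x * algebraMap R K b = algebraMap R K a)
    (hfin : Module.Finite R (integralClosure R K)) : IsDedekindDomain (integralClosure R K) := by
  have hnoeth : IsNoetherianRing (integralClosure R K) := IsNoetherianRing.of_finite R _
  have hfr : IsFractionRing (integralClosure R K) K := by
    refine IsFractionRing.of_field _ _ fun x => ?_
    obtain ⟨a, b, hb, hab⟩ := hfrac x
    refine ⟨algebraMap R _ a, algebraMap R _ b, ?_⟩
    change x = algebraMap R K a / algebraMap R K b
    rw [eq_div_iff hb, hab]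
  have hic : IsIntegrallyClosed (integralClosure R K) := by
    rw [isIntegrallyClosed_iff K]
    intro x hx
    exact ⟨⟨x, isIntegral_trans x hx⟩, rfl⟩
  have hdim : Ring.DimensionLEOne (integralClosure R K) := by
    refine ⟨fun {P} hP hPp => ?_⟩
    have hint : Algebra.IsIntegral R (integralClosure R K) := inferInstance
    rcases Ring.krullDimLE_one_iff.1 hd (P.comap (algebraMap R (integralClosure R K)))
      inferInstance with h | h
    · exfalso
      obtain ⟨x, hx, hx0⟩ := Submodule.exists_mem_ne_zero_of_ne_bot hP
      have := Ideal.comap_lt_comap_of_integral_mem_sdiff (R := R) (I := (⊥ : Ideal (integralClosure R K)))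
        (J := P) bot_le ⟨hx, hx0⟩ (hint.isIntegral x)
      exact absurd (h.2 ⟨inferInstance, bot_le⟩ this.le) this.not_ge
    · exact Ideal.isMaximal_of_isIntegral_of_isMaximal_comap P h
  exact { }

theorem proj_aux (D : Type u) [CommRing D] [IsDedekindDomain D] (n : ℕ)
    (N : Submodule D (Fin n → D)) : Module.Projective D N := by
  have : Module.Finite D N := inferInstance
  have : Module.Flat D N := inferInstance
  have : Module.FinitePresentation D N := Module.finitePresentation_of_finite D N
  exact Module.Flat.projective_of_finitePresentation

theorem key_dedekind (D : Type u) [CommRing D] [IsDedekindDomain D] [Algebra R D]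
    (δ : D →ₗ[R] R)
    {M : Type u} [AddCommGroup M] [Module R M] {n k : ℕ} (ι : M →ₗ[R] (Fin n → R))
    (hι : Function.Injective ι) (p : (Fin k → R) →ₗ[R] M) (hp : Function.Surjective p) :
    ∃ h : M →ₗ[R] (Fin k → R), ∀ m, p (h m) = δ 1 • m := by
  let b : Fin k → Fin n → D := fun i j => algebraMap R D (ι (p (Pi.single i 1)) j)
  let A : (Fin k → D) →ₗ[D] (Fin n → D) := Fintype.linearCombination D b
  let N := LinearMap.range A
  have hproj : Module.Projective D N := proj_aux D n N
  obtain ⟨s, hs⟩ := Module.projective_lifting_property A.rangeRestrict LinearMap.id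
    A.surjective_rangeRestrict
  let ψ : M →ₗ[R] (Fin n → D) := (Algebra.linearMap R D).compLeft (Fin n) ∘ₗ ι
  have h1 : ∀ x : Fin k → R, x = ∑ i, x i • Pi.single i (1 : R) := fun x => by
    ext j; simp [Finset.sum_apply, Pi.single_apply]
  have hψ : ∀ m, ψ m ∈ N.restrictScalars R := by
    intro m
    obtain ⟨x, rfl⟩ := hp m
    refine ⟨fun i => algebraMap R D (x i), ?_⟩
    ext1 j
    rw [Fintype.linearCombination_apply, Finset.sum_apply]
    change _ = algebraMap R D (ι (p x) j)
    conv_rhs => rw [h1 x]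
    simp only [map_sum, map_smul, Finset.sum_apply, Pi.smul_apply, smul_eq_mul, map_mul, b]
  let ψ' : M →ₗ[R] N := LinearMap.codRestrict (N.restrictScalars R) ψ hψ
  let h : M →ₗ[R] (Fin k → R) := δ.compLeft (Fin k) ∘ₗ (s.restrictScalars R) ∘ₗ ψ'
  refine ⟨h, fun m => hι ?_⟩
  ext j
  have e1 : A (s (ψ' m)) j = algebraMap R D (ι m j) := by
    have := congrArg Subtype.val (LinearMap.congr_fun hs (ψ' m))
    exact congrFun this j
  have e2 : h m = fun i => δ (s (ψ' m) i) := rfl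
  rw [h1 (h m)]
  simp only [map_sum, map_smul, Finset.sum_apply, Pi.smul_apply, smul_eq_mul]
  rw [Fintype.linearCombination_apply, Finset.sum_apply] at e1
  have e3 := congrArg δ e1
  rw [map_sum, Algebra.algebraMap_eq_smul_one, map_smul, smul_eq_mul] at e3
  rw [mul_comm, ← e3]
  refine Finset.sum_congr rfl fun i _ => ?_
  rw [e2, mul_comm, ← smul_eq_mul, ← map_smul]
  congr 1
  simp only [b, Pi.smul_apply, smul_eq_mul]
  rw [Algebra.smul_def, mul_comm]

theorem key_field (hd : Ring.KrullDimLE 1 R) (K : Type u) [Field K] [Algebra R K]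
    (hfrac : ∀ x : K, ∃ a b : R, algebraMap R K b ≠ 0 ∧ x * algebraMap R K b = algebraMap R K a)
    (δ : integralClosure R K →ₗ[R] R) (hδ : Function.Injective δ)
    {M : Type u} [AddCommGroup M] [Module R M] {n k : ℕ} (ι : M →ₗ[R] (Fin n → R))
    (hι : Function.Injective ι) (p : (Fin k → R) →ₗ[R] M) (hp : Function.Surjective p) :
    ∃ h : M →ₗ[R] (Fin k → R), ∀ m, p (h m) = δ 1 • m := by
  have hfin : Module.Finite R (integralClosure R K) := Module.Finite.of_injective δ hδ
  have hded := dedekind_aux hd K hfrac hfin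
  exact key_dedekind (integralClosure R K) δ ι hι p hp

theorem artin_aux [IsLocalRing R] (hd : Ring.KrullDimLE 1 R)
    (hCM : ∃ x ∈ IsLocalRing.maximalIdeal R, x ∈ nonZeroDivisors R) :
    IsArtinianRing (Localization (nonZeroDivisors R)) := by
  set Q := Localization (nonZeroDivisors R)
  have hN : IsNoetherianRing Q := IsLocalization.isNoetherianRing (nonZeroDivisors R) Q inferInstance
  obtain ⟨x, hxm, hx⟩ := hCM
  have hmin : ∀ P : Ideal Q, P.IsPrime → P.comap (algebraMap R Q) ∈ minimalPrimes R := by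
    intro P hP
    rcases Ring.krullDimLE_one_iff.1 hd (P.comap (algebraMap R Q)) inferInstance with h | h
    · exact h
    · exfalso
      rw [IsLocalRing.eq_maximalIdeal h |>.symm] at hxm
      exact hP.ne_top (Ideal.eq_top_of_isUnit_mem _ (Ideal.mem_comap.1 hxm)
        (IsLocalization.map_units Q (⟨x, hx⟩ : nonZeroDivisors R)))
  have h0 : Ring.KrullDimLE 0 Q := by
    refine Ring.krullDimLE_zero_iff.2 fun P hP => ?_
    obtain ⟨P', hP', hle⟩ := Ideal.exists_le_maximal P hP.ne_top
    have h1 := hmin P hP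
    have h2 := hmin P' hP'.isPrime
    have h3 : P'.comap (algebraMap R Q) ≤ P.comap (algebraMap R Q) :=
      h2.2 h1.1 (Ideal.comap_mono hle)
    have h4 : P' ≤ P := by
      rw [← IsLocalization.map_under (nonZeroDivisors R) Q P',
        ← IsLocalization.map_under (nonZeroDivisors R) Q P]
      exact Ideal.map_mono h3
    rwa [le_antisymm hle h4]
  exact IsNoetherianRing.isArtinianRing_of_krullDimLE_zero

theorem integral_single {ι : Type u} [DecidableEq ι] (K : ι → Type u) [∀ i, CommRing (K i)]
    [∀ i, Algebra R (K i)] (i : ι) (d : K i) (hd : IsIntegral R d) :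
    IsIntegral R (Pi.single i d : ∀ i, K i) := by
  obtain ⟨f, hf, hfd⟩ := hd
  refine ⟨Polynomial.X * f, Polynomial.monic_X.mul hf, ?_⟩
  rw [← Polynomial.aeval_def]
  ext j
  have : (Polynomial.aeval (Pi.single i d : ∀ i, K i) (Polynomial.X * f)) j =
    Polynomial.aeval ((Pi.single i d : ∀ i, K i) j) (Polynomial.X * f) :=
    (Polynomial.aeval_algHom_apply (Pi.evalAlgHom R K j) _ _).symm
  rw [this, map_mul, Polynomial.aeval_X]
  by_cases h : j = i
  · subst h
    rw [Pi.single_eq_same, Polynomial.aeval_def, hfd, mul_zero]; rfl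
  · rw [Pi.single_eq_of_ne h, zero_mul]; rfl

theorem key_factor [IsLocalRing R] (hd : Ring.KrullDimLE 1 R)
    (hCM : ∃ x ∈ IsLocalRing.maximalIdeal R, x ∈ nonZeroDivisors R) (hred : IsReduced R)
    (c : R) (hc : c ∈ conductorIdeal R)
    {M : Type u} [AddCommGroup M] [Module R M] {n k : ℕ} (ι : M →ₗ[R] (Fin n → R))
    (hι : Function.Injective ι) (p : (Fin k → R) →ₗ[R] M) (hp : Function.Surjective p) :
    ∃ h : M →ₗ[R] (Fin k → R), ∀ m, p (h m) = c • m := by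
  classical
  have hart := artin_aux hd hCM
  rw [conductorIdeal, Submodule.mem_comap, Submodule.mem_div_iff_forall_mul_mem] at hc
  have hredQ : IsReduced (Localization (nonZeroDivisors R)) := inferInstance
  set Q := Localization (nonZeroDivisors R)
  have hinj : Function.Injective (algebraMap R Q) := IsLocalization.injective Q le_rfl
  let E : Q ≃ₐ[R] (∀ I : MaximalSpectrum Q, Q ⧸ I.asIdeal) := (IsArtinianRing.equivPi Q).restrictScalars R
  have hE : ∀ q I, E q I = Ideal.Quotient.mk I.asIdeal q := fun q I => rfl
  have hE1 : ∀ (r : R) I, E (algebraMap R Q r) I = algebraMap R (Q ⧸ I.asIdeal) r := fun q I => rfl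
  let e := LinearEquiv.ofInjective (Algebra.linearMap R Q) hinj
  have he : ∀ x, algebraMap R Q (e.symm x) = x := fun x =>
    congrArg Subtype.val (e.apply_symm_apply x)
  let γ : ∀ I : MaximalSpectrum Q, integralClosure R (Q ⧸ I.asIdeal) →ₗ[R] Q := fun I =>
    LinearMap.lsmul R Q c ∘ₗ E.symm.toLinearMap ∘ₗ
      LinearMap.single R (fun I : MaximalSpectrum Q => Q ⧸ I.asIdeal) I ∘ₗ
      (integralClosure R (Q ⧸ I.asIdeal)).val.toLinearMap
  have hγ : ∀ I d, γ I d = algebraMap R Q c * E.symm (Pi.single I d.1) := by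
    intro I d
    change c • E.symm (Pi.single I d.1) = _
    rw [Algebra.smul_def]
  have hγ1 : ∀ I d, γ I d ∈ LinearMap.range (Algebra.linearMap R Q) := by
    intro I d
    rw [hγ, ← Submodule.one_eq_range]
    apply hc
    exact (integral_single (fun I : MaximalSpectrum Q => Q ⧸ I.asIdeal) I d.1 d.2).map E.symm
  let δ : ∀ I : MaximalSpectrum Q, integralClosure R (Q ⧸ I.asIdeal) →ₗ[R] R := fun I =>
    e.symm.toLinearMap ∘ₗ LinearMap.codRestrict _ (γ I) (hγ1 I)
  have hδ : ∀ I d, algebraMap R Q (δ I d) = algebraMap R Q c * E.symm (Pi.single I d.1) :=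
    fun I d => (he _).trans (hγ I d)
  have hδE : ∀ I d, E (algebraMap R Q (δ I d)) I = algebraMap R (Q ⧸ I.asIdeal) c * d.1 := by
    intro I d
    rw [hδ, map_mul, AlgEquiv.apply_symm_apply, Pi.mul_apply, Pi.single_eq_same, hE1]
  have hI : ∀ I, ∃ h : M →ₗ[R] (Fin k → R), ∀ m, p (h m) = δ I 1 • m := by
    intro I
    letI : Field (Q ⧸ I.asIdeal) := Ideal.Quotient.field I.asIdeal
    by_cases hcI : algebraMap R (Q ⧸ I.asIdeal) c = 0
    · refine ⟨0, fun m => ?_⟩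
      have : δ I 1 = 0 := by
        apply hinj
        rw [map_zero, hδ]
        apply E.injective
        rw [map_zero, map_mul, AlgEquiv.apply_symm_apply]
        ext J
        rw [Pi.mul_apply, hE1]
        by_cases hJ : J = I
        · subst hJ; rw [hcI, zero_mul]; rfl
        · rw [Pi.single_eq_of_ne hJ, mul_zero]; rfl
      rw [this]; simp
    · refine key_field hd (Q ⧸ I.asIdeal) ?_ (δ I) ?_ ι hι p hp
      · intro x
        obtain ⟨q, rfl⟩ := Ideal.Quotient.mk_surjective x
        obtain ⟨⟨a, b⟩, hab⟩ := IsLocalization.surj (nonZeroDivisors R) q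
        refine ⟨a, b, ?_, ?_⟩
        · exact ((IsLocalization.map_units Q b).map (Ideal.Quotient.mk I.asIdeal)).ne_zero
        · exact congrArg (Ideal.Quotient.mk I.asIdeal) hab
      · intro x y hxy
        have := hδE I x
        rw [hxy, hδE I y] at this
        exact Subtype.ext (mul_left_cancel₀ hcI this.symm)
  choose h hh using hI
  have : Fintype (MaximalSpectrum Q) := Fintype.ofFinite _
  refine ⟨∑ I, h I, fun m => ?_⟩
  rw [LinearMap.sum_apply, map_sum]
  simp only [hh]
  rw [← Finset.sum_smul]
  congr 1
  apply hinj
  rw [map_sum]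
  simp only [hδ]
  rw [← Finset.mul_sum, ← map_sum]
  have : (∑ I : MaximalSpectrum Q, Pi.single I (1 : integralClosure R (Q ⧸ I.asIdeal)).1) =
      (1 : ∀ I : MaximalSpectrum Q, Q ⧸ I.asIdeal) :=
    Finset.univ_sum_single (1 : ∀ I : MaximalSpectrum Q, Q ⧸ I.asIdeal)
  rw [this, map_one, mul_one]
end key

/-- Let `(R, 𝔪)` be a one-dimensional Gorenstein Noetherian local ring (Cohen–Macaulay of Krull
dimension one — i.e. the maximal ideal contains a non-zero-divisor — with injective dimension at
most `1` as a module over itself, encoded by the vanishing of `Ext^i_R(N, R)` for all `i ≥ 2` and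
all `R`-modules `N`) whose `𝔪`-adic completion is reduced.  Then for every `n ≥ 2` the ideal
`ca^n(R)` equals the conductor `𝒞(R)`; consequently the cohomology annihilator
`ca(R) = ⋃_{n ≥ 1} ca^n(R)` equals `𝒞(R)`. -/
theorem cohomologyAnnihilator_eq_conductor (R : Type u) [CommRing R] [IsNoetherianRing R]
    [IsLocalRing R] (hdim : ringKrullDim R = 1)
    (hCM : ∃ x ∈ IsLocalRing.maximalIdeal R, x ∈ nonZeroDivisors R)
    (hGor : ∀ (N : ModuleCat.{u} R) (i : ℕ), 2 ≤ i →
      Subsingleton (((Ext R (ModuleCat.{u} R) i).obj (op N)).obj (ModuleCat.of R R)))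
    (hred : IsReduced (AdicCompletion (IsLocalRing.maximalIdeal R) R)) :
    (∀ n : ℕ, 2 ≤ n → cohomologyAnnihilator R n = conductorIdeal R) ∧
    (⋃ (n : ℕ) (_ : 1 ≤ n), ((cohomologyAnnihilator R n : Ideal R) : Set R)) =
      ((conductorIdeal R : Ideal R) : Set R) := by
  have hd : Ring.KrullDimLE 1 R := Ring.krullDimLE_iff.2 (by rw [hdim]; rfl)
  have hredR : IsReduced R := isReduced_of_injective
    (algebraMap R (AdicCompletion (IsLocalRing.maximalIdeal R) R))
    (AdicCompletion.of_injective (IsLocalRing.maximalIdeal R) R)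
  have G : ∀ (X : Type u) [AddCommGroup X] [Module R X], Ek (1 : R) 1 X R := by
    intro X _ _
    refine (ext_ann_iff (ModuleCat.of R X) (ModuleCat.of R R) 1 1).1 ?_
    have := hGor (ModuleCat.of R X) 2 le_rfl
    rw [Module.mem_annihilator]
    intro m
    exact Subsingleton.elim _ _
  have hle : ∀ n : ℕ, 1 ≤ n → cohomologyAnnihilator R n ≤ conductorIdeal R := by
    intro n hn r hr
    obtain ⟨n, rfl⟩ : ∃ m, n = m + 1 := ⟨n - 1, by omega⟩
    apply mem_conductor_of_Ek
    apply TL_descend G r n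
    intro M N _ _ _ _ hM hN
    refine (ext_ann_iff (ModuleCat.of R M) (ModuleCat.of R N) n r).1 ?_
    simp only [cohomologyAnnihilator, Submodule.mem_iInf] at hr
    exact hr (n+1) le_rfl (ModuleCat.of R M) hM.1 (ModuleCat.of R N) hN
  have hge : ∀ n : ℕ, 2 ≤ n → conductorIdeal R ≤ cohomologyAnnihilator R n := by
    intro n hn c hc
    simp only [cohomologyAnnihilator, Submodule.mem_iInf]
    intro i hi M hM N hN
    obtain ⟨i, rfl⟩ : ∃ m, i = m + 1 + 1 := ⟨i - 2, by omega⟩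
    rw [ext_ann_iff]
    obtain ⟨k, p, hp⟩ := Module.Finite.exists_fin' R M
    obtain ⟨l, q, hq⟩ := Module.Finite.exists_fin' R (LinearMap.ker p)
    obtain ⟨h, hh⟩ := key_factor hd hCM hredR c hc (LinearMap.ker p).subtype
      (LinearMap.ker p).injective_subtype q hq
    exact Ek_up (N := N) (LinearMap.ker p).injective_subtype hp
      (LinearMap.exact_subtype_ker_map p) (Ek_of_factor h hh)
  refine ⟨fun n hn => le_antisymm (hle n (by omega)) (hge n hn), ?_⟩
  ext x
  simp only [Set.mem_iUnion, SetLike.mem_coe]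
  exact ⟨fun ⟨n, hn, hx⟩ => hle n hn hx, fun hx => ⟨2, by norm_num, hge 2 le_rfl hx⟩⟩
end
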